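/- (Pohozaev identity, first identity) Suppose N ≥ 3, f, g : ℝ → ℝ are continuous, and there exist constants C₁, C₂ > 0 such that 0 ≤ t f(t) ≤ C₁(t² + |t|^{2*}) and 0 ≤ t g(t) ≤ C₂(t² + |t|^{2_*}) for all t ∈ ℝ. Let u ∈ C²(ℝ^N_+) ∩ C¹(closure of ℝ^N_+) satisfy ∫_{ℝ^N_+} K(x)(|∇u|² + u²) dx < ∞, -Δu(x) - (1/2)(x·∇u(x)) = f(u(x)) for all x ∈ ℝ^N_+, and -∂u/∂x_N(x',0) = g(u(x',0)) for all x' ∈ ℝ^{N-1}. Then ∫_{ℝ^N_+} |∇u|² dx - ∫_{ℝ^N_+} u f(u) dx - ∫_{ℝ^{N-1}} u(x',0) g(u(x',0)) dx' = -(N/4) ∫_{ℝ^N_+} u² dx. -/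

import Mathlib

open MeasureTheory Real Topology Filter

noncomputable section

/-- `ℝ^N` as Euclidean space. -/
abbrev Euc (N : ℕ) := EuclideanSpace ℝ (Fin N)

/-- Gaussian-type weight `K(x) = exp(|x|²/4)`. -/
noncomputable def Kw {N : ℕ} (x : Euc N) : ℝ := Real.exp (‖x‖ ^ 2 / 4)

/-- critical Sobolev exponent `2* = 2N/(N-2)` -/
noncomputable def twoStar (N : ℕ) : ℝ := 2 * (N : ℝ) / ((N : ℝ) - 2)

/-- critical trace exponent `2_* = 2(N-1)/(N-2)` -/
noncomputable def twoStarL (N : ℕ) : ℝ := 2 * ((N : ℝ) - 1) / ((N : ℝ) - 2)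

/-- `i`-th partial derivative of `u` at `x` -/
noncomputable def pd {N : ℕ} (u : Euc N → ℝ) (i : Fin N) (x : Euc N) : ℝ :=
  fderiv ℝ u x (EuclideanSpace.single i 1)

/-- `|∇u(x)|²` -/
noncomputable def gradSq {N : ℕ} (u : Euc N → ℝ) (x : Euc N) : ℝ :=
  ∑ i, (pd u i x) ^ 2

/-- `x · ∇u(x)` -/
noncomputable def radial {N : ℕ} (u : Euc N → ℝ) (x : Euc N) : ℝ :=
  ∑ i, x i * pd u i x

/-- Laplacian `Δu(x)` -/
noncomputable def lap {N : ℕ} (u : Euc N → ℝ) (x : Euc N) : ℝ :=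
  ∑ i, pd (pd u i) i x

/-- index of the vertical coordinate `x_N` -/
def lastIdx (N : ℕ) (h : 0 < N) : Fin N := ⟨N - 1, by omega⟩

/-- open upper half-space `ℝ^N_+` -/
def upperHS (N : ℕ) (h : 0 < N) : Set (Euc N) := {x | 0 < x (lastIdx N h)}

/-- closed upper half-space -/
def upperHSc (N : ℕ) (h : 0 < N) : Set (Euc N) := {x | 0 ≤ x (lastIdx N h)}

/-- boundary hyperplane `∂ℝ^N_+` -/
def bdryHS (N : ℕ) (h : 0 < N) : Set (Euc N) := {x | x (lastIdx N h) = 0}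

/-- vertical derivative `∂u/∂x_N`, taken within the closed half-space -/
noncomputable def pdN (N : ℕ) (h : 0 < N) (u : Euc N → ℝ) (x : Euc N) : ℝ :=
  fderivWithin ℝ u (upperHSc N h) x (EuclideanSpace.single (lastIdx N h) 1)

/-- embedding of `ℝ^{N-1}` as the boundary of the half-space, `y ↦ (y, 0)` -/
noncomputable def emb (N : ℕ) (y : Euc (N - 1)) : Euc N :=
  (EuclideanSpace.equiv (Fin N) ℝ).symm
    (fun i => if hi : (i : ℕ) < N - 1 then y ⟨(i : ℕ), hi⟩ else 0)

/-- finite weighted energy, i.e. membership in the space `X` -/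
def FiniteEnergy (N : ℕ) (h : 0 < N) (u : Euc N → ℝ) : Prop :=
  IntegrableOn (fun x => Kw x * (gradSq u x + (u x) ^ 2)) (upperHS N h)

/-- classical solution of problem (1.1) -/
structure IsClassicalSolution (N : ℕ) (h : 0 < N) (lam mu p : ℝ) (u : Euc N → ℝ) : Prop where
  smooth2 : ContDiffOn ℝ 2 u (upperHS N h)
  smooth1 : ContDiffOn ℝ 1 u (upperHSc N h)
  pde : ∀ x ∈ upperHS N h,
    -lap u x - (1 / 2) * radial u x
      = lam * |u x| ^ (twoStar N - 2) * u x + mu * |u x| ^ (p - 2) * u x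
  bc : ∀ x ∈ bdryHS N h,
    -pdN N h u x = Real.sqrt lam * |u x| ^ (twoStarL N - 2) * u x

/-- `x_N⁰ = √(N/(N-2))` -/
noncomputable def xN0 (N : ℕ) : ℝ := Real.sqrt ((N : ℝ) / ((N : ℝ) - 2))

/-- `k_N = (N(N-2))^{(N-2)/4}` -/
noncomputable def kN (N : ℕ) : ℝ := ((N : ℝ) * ((N : ℝ) - 2)) ^ (((N : ℝ) - 2) / 4)

/-- `|x'|²`, squared norm of the horizontal part -/
noncomputable def horizSq {N : ℕ} (h : 0 < N) (x : Euc N) : ℝ :=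
  ∑ i ∈ Finset.univ.erase (lastIdx N h), (x i) ^ 2

/-- the family `φ_{ε,τ}` -/
noncomputable def bubbleT (N : ℕ) (h : 0 < N) (ε τ : ℝ) (x : Euc N) : ℝ :=
  (ε * Real.sqrt ((N : ℝ) * ((N : ℝ) - 2)) /
      (ε ^ 2 + horizSq h x + (x (lastIdx N h) + ε * τ * xN0 N) ^ 2)) ^ (((N : ℝ) - 2) / 2)

/-- the boundary bubble `U_ε = φ_{ε,1}` -/
noncomputable def Ubub (N : ℕ) (h : 0 < N) (ε : ℝ) (x : Euc N) : ℝ := bubbleT N h ε 1 x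

/-- `K₁ = ∫_{ℝ^N_+} |∇U_ε|²` (an `ε`-independent constant, computed at `ε = 1`) -/
noncomputable def Kone (N : ℕ) (h : 0 < N) : ℝ :=
  ∫ x in upperHS N h, gradSq (Ubub N h 1) x

/-- `K₂ = ∫_{ℝ^N_+} U_ε^{2*}` -/
noncomputable def Ktwo (N : ℕ) (h : 0 < N) : ℝ :=
  ∫ x in upperHS N h, (Ubub N h 1 x) ^ twoStar N

/-- `K₃ = ∫_{ℝ^{N-1}} U_ε(x',0)^{2_*}` -/
noncomputable def Kthree (N : ℕ) (h : 0 < N) : ℝ :=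
  ∫ y : Euc (N - 1), (Ubub N h 1 (emb N y)) ^ twoStarL N

/-- cut-off function: `φ ∈ C_c^∞(ℝ^N,[0,1])`, `φ ≡ 1` on `B₁(0)`, `φ ≡ 0` outside `B₂(0)` -/
structure IsCutoff (N : ℕ) (φ : Euc N → ℝ) : Prop where
  smooth : ContDiff ℝ (⊤ : ℕ∞) φ
  mem01 : ∀ x, φ x ∈ Set.Icc (0 : ℝ) 1
  eq_one : ∀ x ∈ Metric.closedBall (0 : Euc N) 1, φ x = 1
  eq_zero : ∀ x ∉ Metric.ball (0 : Euc N) 2, φ x = 0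

/-- truncated weighted bubble `Ũ_ε = K^{-1/2} φ U_ε` -/
noncomputable def Ut (N : ℕ) (h : 0 < N) (φ : Euc N → ℝ) (ε : ℝ) (x : Euc N) : ℝ :=
  (Kw x) ^ (-(1 : ℝ) / 2) * φ x * Ubub N h ε x

/-- smooth compactly supported test functions on the closed half-space -/
structure IsTestFun (N : ℕ) (h : 0 < N) (u : Euc N → ℝ) : Prop where
  smooth : ContDiff ℝ (⊤ : ℕ∞) u
  cpt : HasCompactSupport u
  supp : tsupport u ⊆ upperHSc N h

/-- the norm of the space `X`: `‖u‖ = (∫ K |∇u|²)^{1/2}` -/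
noncomputable def Xnorm (N : ℕ) (h : 0 < N) (u : Euc N → ℝ) : ℝ :=
  Real.sqrt (∫ x in upperHS N h, Kw x * gradSq u x)



theorem div_halfspace {n : ℕ} (h : 0 < n + 1) (V : Fin (n+1) → Euc (n+1) → ℝ)
    (V' : Fin (n+1) → Euc (n+1) → (Euc (n+1) →L[ℝ] ℝ)) (D : Euc (n+1) → ℝ) (R : ℝ) (hR : 0 < R)
    (Hc : ∀ i, ContinuousOn (V i) (upperHSc (n+1) h))
    (Hd : ∀ x ∈ upperHS (n+1) h, ∀ i, HasFDerivAt (V i) (V' i x) x)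
    (hD : ∀ x ∈ upperHS (n+1) h, D x = ∑ i, V' i x (EuclideanSpace.single i 1))
    (hV0 : ∀ i x, R ≤ ‖x‖ → V i x = 0) (hD0 : ∀ x, R ≤ ‖x‖ → D x = 0)
    (Hi : IntegrableOn D (upperHS (n+1) h)) :
    ∫ x in upperHS (n+1) h, D x = - ∫ y : Euc n, V (Fin.last n) (emb (n+1) y) := by
  classical
  have hlast : lastIdx (n+1) h = Fin.last n := rfl
  let T : (Fin (n+1) → ℝ) →L[ℝ] Euc (n+1) :=
    ((EuclideanSpace.equiv (Fin (n+1)) ℝ).symm : (Fin (n+1) → ℝ) →L[ℝ] Euc (n+1))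
  have hT : ∀ z, T z = WithLp.toLp 2 z := fun z => rfl
  have hTi : ∀ z i, T z i = z i := fun z i => rfl
  have hTs : ∀ i, T (Pi.single i 1) = EuclideanSpace.single i 1 := fun i => rfl
  have habs : ∀ z i, |z i| ≤ ‖T z‖ := fun z i => by
    have := PiLp.norm_apply_le (T z) i
    simpa [hTi] using this
  have hmp : MeasurePreserving (fun z => T z) volume volume :=
    PiLp.volume_preserving_toLp (Fin (n+1))
  have hme : MeasurableEmbedding (fun z => T z) :=
    (MeasurableEquiv.toLp 2 (Fin (n+1) → ℝ)).measurableEmbedding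
  let U : Set (Fin (n+1) → ℝ) := {z | 0 < z (Fin.last n)}
  have hU : (fun z => T z) ⁻¹' (upperHS (n+1) h) = U := rfl
  have hUm : MeasurableSet U := measurableSet_lt measurable_const (measurable_pi_apply _)
  let a : Fin (n+1) → ℝ := fun i => if i = Fin.last n then 0 else -R
  let b : Fin (n+1) → ℝ := fun i => R
  have hab : a ≤ b := by
    intro i; simp only [a, b]; split_ifs <;> linarith
  let f : Fin (n+1) → (Fin (n+1) → ℝ) → ℝ := fun i z => V i (T z)
  let f' : Fin (n+1) → (Fin (n+1) → ℝ) → ((Fin (n+1) → ℝ) →L[ℝ] ℝ) := fun i z =>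
    if z ∈ U then (V' i (T z)).comp T else 0
  have hdiv : ∀ z, ∑ i, f' i z (Pi.single i 1) = U.indicator (fun z => D (T z)) z := by
    intro z
    by_cases hz : z ∈ U
    · simp only [f', hz, if_true, Set.indicator_of_mem]
      rw [hD _ (by rw [← hU] at hz; exact hz)]
      rfl
    · simp [f', hz]
  have hIU : IntegrableOn (fun z => D (T z)) U := by
    have := (hmp.integrableOn_comp_preimage hme (f := D) (s := upperHS (n+1) h)).2 Hi
    exact this
  have hmain := integral_divergence_of_hasFDerivAt_off_countable' a b hab f f' ∅
    Set.countable_empty ?_ ?_ ?_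
  rotate_left
  · intro i
    refine (Hc i).comp T.continuous.continuousOn ?_
    intro z hz
    have := hz.1 (Fin.last n)
    have h3 : 0 ≤ z (Fin.last n) := by simpa [a] using this
    exact h3
  · intro z hz i
    have hzU : z ∈ U := by
      have := (hz.1 (Fin.last n) trivial).1
      have h3 : 0 < z (Fin.last n) := by simpa [a] using this
      exact h3
    simp only [f', hzU, if_true]
    exact (Hd (T z) hzU i).comp z T.hasFDerivAt
  · simp only [hdiv]
    exact ((integrable_indicator_iff hUm).2 hIU).integrableOn
  simp only [hdiv] at hmain
  have hL : ∫ z in Set.Icc a b, U.indicator (fun z => D (T z)) z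
      = ∫ x in upperHS (n+1) h, D x := by
    rw [← hmp.setIntegral_preimage_emb hme, hU, ← integral_indicator hUm]
    apply setIntegral_eq_integral_of_forall_compl_eq_zero
    intro z hz
    by_cases hzU : z ∈ U
    · rw [Set.indicator_of_mem hzU]
      apply hD0
      by_contra hlt
      push Not at hlt
      apply hz
      have hb : ∀ i, |z i| < R := fun i => (habs z i).trans_lt hlt
      constructor
      · intro i
        simp only [a]; split_ifs with hi
        · subst hi; exact le_of_lt hzU
        · exact (abs_lt.1 (hb i)).1.le
      · intro i; exact (abs_lt.1 (hb i)).2.le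
    · rw [Set.indicator_of_notMem hzU]
  rw [hL] at hmain
  rw [hmain, Finset.sum_eq_single (Fin.last n)]
  · have h1 : ∀ x : Fin n → ℝ, f (Fin.last n) ((Fin.last n).insertNth (b (Fin.last n)) x) = 0 := by
      intro x
      apply hV0
      refine le_trans ?_ (habs _ (Fin.last n))
      simp [b, abs_of_pos hR]
    simp only [h1, integral_zero, zero_sub]
    congr 1
    have hmp' : MeasurePreserving (fun z : Fin n → ℝ => WithLp.toLp 2 z) volume volume :=
      PiLp.volume_preserving_toLp (Fin n)
    have hme' : MeasurableEmbedding (fun z : Fin n → ℝ => WithLp.toLp 2 z) :=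
      (MeasurableEquiv.toLp 2 (Fin n → ℝ)).measurableEmbedding
    rw [← hmp'.integral_comp hme']
    have h2 : ∀ x : Fin n → ℝ, T ((Fin.last n).insertNth (a (Fin.last n)) x)
        = emb (n+1) (WithLp.toLp 2 x : Euc n) := by
      intro x
      ext i
      rw [hTi]
      refine Fin.lastCases ?_ (fun j => ?_) i
      · simp [a, emb]
      · simp [emb, Fin.insertNth_last']
    simp only [f, h2]
    apply setIntegral_eq_integral_of_forall_compl_eq_zero
    intro x hx
    apply hV0
    by_contra hlt
    push Not at hlt
    apply hx
    rw [← h2] at hlt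
    have hb : ∀ i, |x i| < R := fun i => by
      have := (habs _ (Fin.castSucc i)).trans_lt hlt
      simpa [Fin.insertNth_last'] using this
    constructor
    · intro i
      simp only [a, Function.comp, Fin.succAbove_last, Fin.castSucc_ne_last, if_false]
      exact (abs_lt.1 (hb i)).1.le
    · intro i; exact (abs_lt.1 (hb i)).2.le
  · intro i _ hi
    have h1 : ∀ x : Fin n → ℝ, f i (i.insertNth (b i) x) = 0 := by
      intro x
      apply hV0
      refine le_trans ?_ (habs _ i)
      simp [b, abs_of_pos hR]
    have h2 : ∀ x : Fin n → ℝ, f i (i.insertNth (a i) x) = 0 := by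
      intro x
      apply hV0
      refine le_trans ?_ (habs _ i)
      simp [a, hi, abs_of_pos hR]
    simp only [h1, h2, integral_zero, sub_zero]
  · simp

theorem hasDerivAt_posSq (t : ℝ) : HasDerivAt (fun s : ℝ => (max 0 s) ^ 2) (2 * max 0 t) t := by
  rcases lt_trichotomy t 0 with ht | rfl | ht
  · have : (fun s : ℝ => (max 0 s) ^ 2) =ᶠ[𝓝 t] fun _ => 0 := by
      filter_upwards [eventually_lt_nhds ht] with s hs
      rw [max_eq_left hs.le]; simp
    rw [max_eq_left ht.le, mul_zero]
    exact (hasDerivAt_const t (0:ℝ)).congr_of_eventuallyEq this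
  · rw [max_self, mul_zero, hasDerivAt_iff_isLittleO]
    have h : (fun s : ℝ => s ^ 2) =o[𝓝 0] fun s : ℝ => s := by
      simpa using Asymptotics.isLittleO_pow_id (𝕜 := ℝ) (n := 2) (by norm_num)
    have h2 : (fun s : ℝ => (max 0 s) ^ 2) =O[𝓝 0] fun s : ℝ => s ^ 2 := by
      refine Asymptotics.IsBigO.of_bound 1 (Eventually.of_forall fun s => ?_)
      rw [one_mul, norm_pow, norm_pow]
      gcongr
      rw [Real.norm_eq_abs, Real.norm_eq_abs, abs_of_nonneg (le_max_left _ _)]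
      exact max_le (abs_nonneg _) (le_abs_self _)
    simpa using h2.trans_isLittleO h
  · have : (fun s : ℝ => (max 0 s) ^ 2) =ᶠ[𝓝 t] fun s => s ^ 2 := by
      filter_upwards [eventually_gt_nhds ht] with s hs
      rw [max_eq_right hs.le]
    rw [max_eq_right ht.le]
    have := (hasDerivAt_pow 2 t).congr_of_eventuallyEq this
    simpa using this

/-- the cutoff -/
def cutη {N : ℕ} (R : ℝ) (x : Euc N) : ℝ := (max 0 (1 - ‖x‖ ^ 2 / R ^ 2)) ^ 2

def cutc {N : ℕ} (R : ℝ) (x : Euc N) : ℝ := -(4 / R ^ 2 * max 0 (1 - ‖x‖ ^ 2 / R ^ 2))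

theorem cutη_hasFDerivAt {N : ℕ} (R : ℝ) (x : Euc N) :
    HasFDerivAt (cutη R) (cutc R x • (innerSL ℝ x)) x := by
  have h1 : HasFDerivAt (fun y : Euc N => 1 - ‖y‖ ^ 2 / R ^ 2) (-((R ^ 2)⁻¹ • (2 • innerSL ℝ x))) x := by
    have := (((hasStrictFDerivAt_norm_sq x).hasFDerivAt).const_mul ((R ^ 2)⁻¹)).const_sub 1
    refine this.congr_of_eventuallyEq (Eventually.of_forall fun y => ?_)
    simp only [div_eq_inv_mul]
  have h2 := (hasDerivAt_posSq (1 - ‖x‖ ^ 2 / R ^ 2)).comp_hasFDerivAt x h1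
  have h3 : cutc R x • (innerSL ℝ x)
      = (2 * max 0 (1 - ‖x‖ ^ 2 / R ^ 2)) • (-((R ^ 2)⁻¹ • (2 • innerSL ℝ x))) := by
    ext v
    simp only [cutc, _root_.smul_apply, _root_.neg_apply, smul_eq_mul,
      nsmul_eq_mul, Nat.cast_ofNat]
    ring
  rw [h3]
  exact h2

theorem cutη_cont {N : ℕ} (R : ℝ) : Continuous (cutη R : Euc N → ℝ) := by
  unfold cutη; fun_prop

theorem cutc_cont {N : ℕ} (R : ℝ) : Continuous (cutc R : Euc N → ℝ) := by
  unfold cutc; fun_prop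

theorem cutη_nonneg {N : ℕ} (R : ℝ) (x : Euc N) : 0 ≤ cutη R x := by unfold cutη; positivity

theorem cut_aux {N : ℕ} (R : ℝ) (x : Euc N) : max 0 (1 - ‖x‖ ^ 2 / R ^ 2) ≤ 1 := by
  apply max_le zero_le_one
  have : 0 ≤ ‖x‖ ^ 2 / R ^ 2 := by positivity
  linarith

theorem cutη_le_one {N : ℕ} (R : ℝ) (x : Euc N) : cutη R x ≤ 1 := by
  unfold cutη
  exact pow_le_one₀ (le_max_left _ _) (cut_aux R x)

theorem cutc_abs {N : ℕ} (R : ℝ) (x : Euc N) : |cutc R x| ≤ 4 / R ^ 2 := by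
  unfold cutc
  have h0 := le_max_left 0 (1 - ‖x‖ ^ 2 / R ^ 2)
  rw [abs_neg, abs_of_nonneg (by positivity)]
  exact mul_le_of_le_one_right (by positivity) (cut_aux R x)

theorem cut_zero {N : ℕ} {R : ℝ} (hR : 0 < R) (x : Euc N) (hx : R ≤ ‖x‖) :
    max 0 (1 - ‖x‖ ^ 2 / R ^ 2) = 0 := by
  apply max_eq_left
  have : 1 ≤ ‖x‖ ^ 2 / R ^ 2 := by
    rw [one_le_div (by positivity)]; gcongr
  linarith

theorem cutη_zero {N : ℕ} {R : ℝ} (hR : 0 < R) (x : Euc N) (hx : R ≤ ‖x‖) : cutη R x = 0 := by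
  simp [cutη, cut_zero hR x hx]

theorem cutc_zero {N : ℕ} {R : ℝ} (hR : 0 < R) (x : Euc N) (hx : R ≤ ‖x‖) : cutc R x = 0 := by
  simp [cutc, cut_zero hR x hx]

theorem cutη_tendsto {N : ℕ} (x : Euc N) :
    Tendsto (fun k : ℕ => cutη ((k : ℝ) + 1) x) atTop (𝓝 1) := by
  have h0 : Tendsto (fun k : ℕ => (k : ℝ) + 1) atTop atTop :=
    tendsto_atTop_add_const_right _ _ tendsto_natCast_atTop_atTop
  have h1 : Tendsto (fun k : ℕ => ‖x‖ ^ 2 / ((k : ℝ) + 1) ^ 2) atTop (𝓝 0) :=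
    ((tendsto_pow_atTop (two_ne_zero)).comp h0).const_div_atTop _
  have h2 : Tendsto (fun k : ℕ => (max 0 (1 - ‖x‖ ^ 2 / ((k : ℝ) + 1) ^ 2)) ^ 2) atTop
      (𝓝 ((max 0 (1 - 0)) ^ 2)) :=
    ((tendsto_const_nhds.max (tendsto_const_nhds.sub h1))).pow 2
  simpa [cutη] using h2

theorem integrable_of_cut {α : Type*} [MeasurableSpace α] {μ : Measure α} (F : α → ℝ)
    (η : ℕ → α → ℝ) (C : ℝ) (hη : ∀ k x, 0 ≤ η k x)
    (hlim : ∀ x, Tendsto (fun k => η k x) atTop (𝓝 1))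
    (hF : ∀ x, 0 ≤ F x) (hi : ∀ k, Integrable (fun x => η k x * F x) μ)
    (hC : ∀ k, ∫ x, η k x * F x ∂μ ≤ C) : Integrable F μ := by
  have hlim' : ∀ x, Tendsto (fun k => η k x * F x) atTop (𝓝 (F x)) := fun x => by
    simpa using (hlim x).mul_const (F x)
  refine ⟨aestronglyMeasurable_of_tendsto_ae atTop (fun k => (hi k).aestronglyMeasurable)
    (Eventually.of_forall hlim'), ?_⟩
  have h1 : ∫⁻ x, ‖F x‖ₑ ∂μ ≤ liminf (fun k => ∫⁻ x, ‖η k x * F x‖ₑ ∂μ) atTop := by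
    have := lintegral_liminf_le' (μ := μ) (u := atTop) (f := fun k x => ‖η k x * F x‖ₑ)
      (fun k => (hi k).aestronglyMeasurable.enorm)
    refine le_trans (le_of_eq ?_) this
    apply lintegral_congr
    intro x
    exact ((hlim' x).enorm.liminf_eq).symm
  have h2 : ∀ k, ∫⁻ x, ‖η k x * F x‖ₑ ∂μ ≤ ENNReal.ofReal C := by
    intro k
    rw [← ofReal_integral_norm_eq_lintegral_enorm (hi k)]
    apply ENNReal.ofReal_le_ofReal
    refine le_trans (le_of_eq ?_) (hC k)
    apply integral_congr_ae
    refine Eventually.of_forall fun x => ?_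
    exact abs_of_nonneg (mul_nonneg (hη k x) (hF x))
  refine lt_of_le_of_lt (h1.trans ?_) (ENNReal.ofReal_lt_top (r := C))
  refine Filter.liminf_le_of_le (by isBoundedDefault) ?_
  intro b hb
  obtain ⟨k, hk⟩ := hb.exists
  exact hk.trans (h2 k)

theorem emb_norm {n : ℕ} (y : Euc n) : ‖emb (n+1) y‖ = ‖y‖ := by
  rw [EuclideanSpace.norm_eq, EuclideanSpace.norm_eq, Fin.sum_univ_castSucc]
  congr 1
  simp [emb]

theorem emb_cont {n : ℕ} : Continuous (fun y : Euc n => emb (n+1) y) := by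
  unfold emb
  refine (EuclideanSpace.equiv (Fin (n+1)) ℝ).symm.continuous.comp ?_
  refine continuous_pi fun i => ?_
  by_cases hi : (i : ℕ) < n + 1 - 1
  · simp only [hi, dif_pos]; fun_prop
  · simp only [hi, dif_neg, not_false_eq_true]; fun_prop

theorem emb_last {n : ℕ} (h : 0 < n + 1) (y : Euc n) : emb (n+1) y (lastIdx (n+1) h) = 0 := by
  simp [emb, lastIdx]

theorem upperHS_open {n : ℕ} (h : 0 < n + 1) : IsOpen (upperHS (n+1) h) := by
  unfold upperHS
  exact isOpen_lt continuous_const (by fun_prop)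

theorem upperHSc_closed {n : ℕ} (h : 0 < n + 1) : IsClosed (upperHSc (n+1) h) := by
  unfold upperHSc
  exact isClosed_le continuous_const (by fun_prop)

theorem upperHS_sub {n : ℕ} (h : 0 < n + 1) : upperHS (n+1) h ⊆ upperHSc (n+1) h :=
  fun _ hx => le_of_lt (α := ℝ) hx

theorem upperHSc_ud {n : ℕ} (h : 0 < n + 1) : UniqueDiffOn ℝ (upperHSc (n+1) h) := by
  apply uniqueDiffOn_convex
  · intro x hx y hy a b ha hb _
    have hx' : 0 ≤ x (lastIdx (n+1) h) := hx
    have hy' : 0 ≤ y (lastIdx (n+1) h) := hy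
    have : 0 ≤ a * x (lastIdx (n+1) h) + b * y (lastIdx (n+1) h) := by positivity
    exact this
  · refine ⟨EuclideanSpace.single (lastIdx (n+1) h) 1, ?_⟩
    refine interior_maximal (upperHS_sub h) (upperHS_open h) ?_
    simp [upperHS]

/-- identity with cutoff -/
theorem cut_identity {n : ℕ} (h : 0 < n + 1) (f g : ℝ → ℝ)
    (hf : Continuous f)
    (u : Euc (n+1) → ℝ)
    (h2 : ContDiffOn ℝ 2 u (upperHS (n+1) h))
    (h1 : ContDiffOn ℝ 1 u (upperHSc (n+1) h))
    (hpde : ∀ x ∈ upperHS (n+1) h, -lap u x - (1 / 2) * radial u x = f (u x))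
    (hbc : ∀ x ∈ bdryHS (n+1) h, -pdN (n+1) h u x = g (u x))
    (hG : IntegrableOn (gradSq u) (upperHS (n+1) h))
    (hu2 : IntegrableOn (fun x => u x ^ 2) (upperHS (n+1) h))
    (hE : IntegrableOn (fun x => u x * radial u x + 1/4 * (u x ^ 2 * ‖x‖ ^ 2)) (upperHS (n+1) h))
    (R : ℝ) (hR : 0 < R) :
    IntegrableOn (fun x => cutη R x * (u x * f (u x))) (upperHS (n+1) h) ∧
    (∫ x in upperHS (n+1) h, cutη R x * (gradSq u x + (n+1 : ℝ)/4 * u x ^ 2))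
    - (∫ x in upperHS (n+1) h, cutη R x * (u x * f (u x)))
    + (∫ x in upperHS (n+1) h, cutc R x * (u x * radial u x + 1/4 * (u x ^ 2 * ‖x‖ ^ 2)))
    = ∫ y : Euc n, cutη R (emb (n+1) y) * (u (emb (n+1) y) * g (u (emb (n+1) y))) := by
  have hUo := upperHS_open h
  have hUc := upperHSc_closed h
  have hUm := hUo.measurableSet
  have huc : ContinuousOn u (upperHSc (n+1) h) := h1.continuousOn
  have i1 : IntegrableOn (fun x => cutη R x * (u x * f (u x))) (upperHS (n+1) h) := by
    have hc : ContinuousOn (fun x => cutη R x * (u x * f (u x))) (upperHSc (n+1) h) :=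
      (cutη_cont R).continuousOn.mul (huc.mul (hf.comp_continuousOn huc))
    have hk : IsCompact (upperHSc (n+1) h ∩ Metric.closedBall 0 R) :=
      (isCompact_closedBall _ _).inter_left hUc
    have hi := (hc.mono Set.inter_subset_left).integrableOn_compact (μ := volume) hk
    refine IntegrableOn.mono_set (t := upperHSc (n+1) h) ?_ (upperHS_sub h)
    refine hi.of_forall_sdiff_eq_zero hUc.measurableSet ?_
    intro x hx
    have : R ≤ ‖x‖ := by
      by_contra hlt
      push Not at hlt
      exact hx.2 ⟨hx.1, by simpa using hlt.le⟩
    simp [cutη_zero hR x this]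
  have hηb : ∀ᵐ x ∂(volume.restrict (upperHS (n+1) h)), ‖cutη R x‖ ≤ 1 :=
    Eventually.of_forall fun x => by
      rw [Real.norm_eq_abs, abs_of_nonneg (cutη_nonneg R x)]; exact cutη_le_one R x
  have i2 : IntegrableOn (fun x => cutη R x * (gradSq u x + (n+1 : ℝ)/4 * u x ^ 2))
      (upperHS (n+1) h) :=
    Integrable.bdd_mul (hG.add (hu2.const_mul _)) (cutη_cont R).aestronglyMeasurable hηb
  have i3 : IntegrableOn (fun x => cutc R x * (u x * radial u x + 1/4 * (u x ^ 2 * ‖x‖ ^ 2)))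
      (upperHS (n+1) h) :=
    Integrable.bdd_mul hE (cutc_cont R).aestronglyMeasurable
      (Eventually.of_forall fun x => (cutc_abs R x))
  refine ⟨i1, ?_⟩
  have i4 : IntegrableOn (fun x => cutη R x * (gradSq u x + (n+1 : ℝ)/4 * u x ^ 2)
      - cutη R x * (u x * f (u x))) (upperHS (n+1) h) := i2.sub i1
  rw [← integral_sub i2 i1, ← integral_add i4 i3]
  let P : Fin (n+1) → Euc (n+1) → ℝ := fun i x =>
    fderivWithin ℝ u (upperHSc (n+1) h) x (EuclideanSpace.single i 1)
  have hP : ∀ i, ∀ x ∈ upperHS (n+1) h, P i x = pd u i x := by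
    intro i x hx
    have : upperHSc (n+1) h ∈ 𝓝 x := mem_of_superset (hUo.mem_nhds hx) (upperHS_sub h)
    simp only [P, pd, fderivWithin_of_mem_nhds this]
  let V : Fin (n+1) → Euc (n+1) → ℝ := fun i x =>
    cutη R x * (u x * P i x + 1/4 * (u x ^ 2 * x i))
  let V' : Fin (n+1) → Euc (n+1) → (Euc (n+1) →L[ℝ] ℝ) := fun i x =>
    cutη R x • ((u x • fderiv ℝ (pd u i) x + pd u i x • fderiv ℝ u x) +
      (1/4 : ℝ) • (u x ^ 2 • (EuclideanSpace.proj i : Euc (n+1) →L[ℝ] ℝ)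
        + x i • ((2 * u x) • fderiv ℝ u x)))
    + (u x * pd u i x + 1/4 * (u x ^ 2 * x i)) • (cutc R x • (innerSL ℝ x))
  have hdiv := div_halfspace h V V' (fun x => cutη R x * (gradSq u x + (n+1 : ℝ)/4 * u x ^ 2)
      - cutη R x * (u x * f (u x))
      + cutc R x * (u x * radial u x + 1/4 * (u x ^ 2 * ‖x‖ ^ 2))) R hR ?_ ?_ ?_ ?_ ?_
      (i4.add i3)
  · refine hdiv.trans ?_
    rw [← integral_neg]
    apply integral_congr_ae
    refine Eventually.of_forall fun y => ?_
    have hy : emb (n+1) y ∈ bdryHS (n+1) h := emb_last h y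
    have hb := hbc _ hy
    have hPl : P (Fin.last n) (emb (n+1) y) = - g (u (emb (n+1) y)) := by
      rw [← hb, neg_neg]; rfl
    have h0 : emb (n+1) y (Fin.last n) = 0 := hy
    simp only [V, hPl, h0]
    ring
  · intro i
    have hPc : ContinuousOn (P i) (upperHSc (n+1) h) :=
      (h1.continuousOn_fderivWithin (upperHSc_ud h) le_rfl).clm_apply continuousOn_const
    have hxi : Continuous fun x : Euc (n+1) => x i := by fun_prop
    exact (cutη_cont R).continuousOn.mul ((huc.mul hPc).add
      (continuousOn_const.mul ((huc.pow 2).mul hxi.continuousOn)))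
  · intro x hx i
    have hnx := hUo.mem_nhds hx
    have hcx : ContDiffAt ℝ 2 u x := h2.contDiffAt hnx
    have du : HasFDerivAt u (fderiv ℝ u x) x :=
      (hcx.differentiableAt (by norm_num)).hasFDerivAt
    have dpd : HasFDerivAt (pd u i) (fderiv ℝ (pd u i) x) x := by
      have : ContDiffAt ℝ 1 (fderiv ℝ u) x := hcx.fderiv_right (by norm_num)
      have h3 : DifferentiableAt ℝ (fderiv ℝ u) x := this.differentiableAt (by norm_num)
      have h4 : DifferentiableAt ℝ (pd u i) x := h3.clm_apply (differentiableAt_const _)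
      exact h4.hasFDerivAt
    have dxi : HasFDerivAt (fun y : Euc (n+1) => y i)
        (EuclideanSpace.proj i : Euc (n+1) →L[ℝ] ℝ) x :=
      (EuclideanSpace.proj i : Euc (n+1) →L[ℝ] ℝ).hasFDerivAt
    have du2 : HasFDerivAt (fun y => u y ^ 2) ((2 * u x) • fderiv ℝ u x) x := by
      have := du.pow 2
      simpa using this
    have hV := (cutη_hasFDerivAt R x).mul ((du.mul dpd).add ((du2.mul dxi).const_mul (1/4)))
    refine hV.congr_of_eventuallyEq ?_
    filter_upwards [hnx] with y hy
    simp only [V, hP i y hy]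
    rfl
  · intro x hx
    have hterm : ∀ i, V' i x (EuclideanSpace.single i 1) =
        cutη R x * (u x * pd (pd u i) i x + pd u i x ^ 2 + 1/4 * u x ^ 2
          + 1/2 * u x * (x i * pd u i x))
        + cutc R x * (u x * (x i * pd u i x) + 1/4 * (u x ^ 2 * (x i) ^ 2)) := by
      intro i
      have e1 : fderiv ℝ (pd u i) x (EuclideanSpace.single i 1) = pd (pd u i) i x := rfl
      have e2 : fderiv ℝ u x (EuclideanSpace.single i 1) = pd u i x := rfl
      have e3 : inner ℝ x (EuclideanSpace.single i (1:ℝ)) = x i := by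
        simp [EuclideanSpace.inner_single_right]
      have e4 : (EuclideanSpace.proj i : Euc (n+1) →L[ℝ] ℝ) (EuclideanSpace.single i 1) = 1 := by
        simp
      simp only [V', _root_.add_apply, _root_.smul_apply, smul_eq_mul, innerSL_apply_apply, e1, e2,
        e3, e4]
      ring
    simp only [hterm]
    have hl := hpde x hx
    have hnorm : ‖x‖ ^ 2 = ∑ i, x i ^ 2 := EuclideanSpace.real_norm_sq_eq x
    rw [Finset.sum_add_distrib, ← Finset.mul_sum, ← Finset.mul_sum, Finset.sum_add_distrib,
      Finset.sum_add_distrib, Finset.sum_add_distrib, Finset.sum_add_distrib, ← Finset.mul_sum,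
      ← Finset.mul_sum, ← Finset.mul_sum, ← Finset.mul_sum, ← Finset.mul_sum, ← Finset.mul_sum, ← hnorm]
    change _ = cutη R x * (u x * lap u x + gradSq u x + _ + 1/2 * u x * radial u x)
      + cutc R x * (u x * radial u x + _)
    have hl' : lap u x = - f (u x) - 1/2 * radial u x := by linarith
    rw [hl']
    simp only [Finset.sum_const, Finset.card_univ, Fintype.card_fin, nsmul_eq_mul]
    push_cast
    ring
  · intro i x hx
    simp [V, cutη_zero hR x hx]
  · intro x hx
    simp [cutη_zero hR x hx, cutc_zero hR x hx]

theorem core {n : ℕ} (h : 0 < n + 1) (f g : ℝ → ℝ)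
    (hf : Continuous f) (hg : Continuous g)
    (hf0 : ∀ t : ℝ, 0 ≤ t * f t) (hg0 : ∀ t : ℝ, 0 ≤ t * g t)
    (u : Euc (n+1) → ℝ)
    (h2 : ContDiffOn ℝ 2 u (upperHS (n+1) h))
    (h1 : ContDiffOn ℝ 1 u (upperHSc (n+1) h))
    (hX : FiniteEnergy (n+1) h u)
    (hpde : ∀ x ∈ upperHS (n+1) h, -lap u x - (1 / 2) * radial u x = f (u x))
    (hbc : ∀ x ∈ bdryHS (n+1) h, -pdN (n+1) h u x = g (u x)) :
    (∫ x in upperHS (n+1) h, gradSq u x)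
      - (∫ x in upperHS (n+1) h, u x * f (u x))
      - (∫ y : Euc n, u (emb (n+1) y) * g (u (emb (n+1) y)))
      = -(((n+1 : ℕ) : ℝ) / 4) * ∫ x in upperHS (n+1) h, (u x) ^ 2 := by
  have hUo := upperHS_open h
  have hUm := hUo.measurableSet
  have huc : ContinuousOn u (upperHSc (n+1) h) := h1.continuousOn
  have hucU : ContinuousOn u (upperHS (n+1) h) := huc.mono (upperHS_sub h)
  have hpdc : ∀ i, ContinuousOn (pd u i) (upperHS (n+1) h) := fun i =>
    (h2.continuousOn_fderiv_of_isOpen hUo (by norm_num)).clm_apply continuousOn_const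
  have hGc : ContinuousOn (gradSq u) (upperHS (n+1) h) :=
    continuousOn_finsetSum _ fun i _ => (hpdc i).pow 2
  have hrc : ContinuousOn (radial u) (upperHS (n+1) h) :=
    continuousOn_finsetSum _ fun i _ =>
      ContinuousOn.mul (Continuous.continuousOn (by fun_prop)) (hpdc i)
  have hG0 : ∀ x, 0 ≤ gradSq u x := fun x => Finset.sum_nonneg fun i _ => sq_nonneg _
  have hK1 : ∀ x : Euc (n+1), 1 + ‖x‖ ^ 2 / 4 ≤ Kw x := fun x => by
    have := Real.add_one_le_exp (‖x‖ ^ 2 / 4)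
    unfold Kw; linarith
  unfold FiniteEnergy at hX
  have hG : IntegrableOn (gradSq u) (upperHS (n+1) h) := by
    refine Integrable.mono' hX (hGc.aestronglyMeasurable hUm) (Eventually.of_forall fun x => ?_)
    rw [Real.norm_eq_abs, abs_of_nonneg (hG0 x)]
    nlinarith [hK1 x, hG0 x, sq_nonneg (u x), sq_nonneg ‖x‖,
      mul_nonneg (sq_nonneg ‖x‖) (hG0 x), mul_nonneg (sq_nonneg ‖x‖) (sq_nonneg (u x)),
      mul_nonneg (sub_nonneg.2 (hK1 x)) (add_nonneg (hG0 x) (sq_nonneg (u x)))]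
  have hu2 : IntegrableOn (fun x => u x ^ 2) (upperHS (n+1) h) := by
    refine Integrable.mono' hX ((hucU.pow 2).aestronglyMeasurable hUm)
      (Eventually.of_forall fun x => ?_)
    rw [Real.norm_eq_abs, abs_of_nonneg (sq_nonneg _)]
    nlinarith [hK1 x, hG0 x, sq_nonneg (u x), sq_nonneg ‖x‖,
      mul_nonneg (sq_nonneg ‖x‖) (hG0 x), mul_nonneg (sq_nonneg ‖x‖) (sq_nonneg (u x)),
      mul_nonneg (sub_nonneg.2 (hK1 x)) (add_nonneg (hG0 x) (sq_nonneg (u x)))]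
  have hrad : ∀ x, radial u x ^ 2 ≤ ‖x‖ ^ 2 * gradSq u x := fun x => by
    rw [EuclideanSpace.real_norm_sq_eq x]
    exact Finset.sum_mul_sq_le_sq_mul_sq Finset.univ (fun i => x i) (fun i => pd u i x)
  have hEb : ∀ x, ‖u x * radial u x + 1/4 * (u x ^ 2 * ‖x‖ ^ 2)‖
      ≤ 8 * (Kw x * (gradSq u x + u x ^ 2)) := fun x => by
    have hr := hrad x
    have key : |u x * radial u x| ≤ u x ^ 2 * ‖x‖ ^ 2 + gradSq u x := by
      apply abs_le_of_sq_le_sq _ (by have := hG0 x; positivity)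
      have a1 : (u x * radial u x) ^ 2 ≤ u x ^ 2 * (‖x‖ ^ 2 * gradSq u x) := by
        rw [mul_pow]; gcongr
      have a2 : 0 ≤ u x ^ 2 * ‖x‖ ^ 2 * gradSq u x := by have := hG0 x; positivity
      nlinarith [sq_nonneg (u x ^ 2 * ‖x‖ ^ 2), sq_nonneg (gradSq u x)]
    have b1 : (1 + ‖x‖ ^ 2 / 4) * (gradSq u x + u x ^ 2) ≤ Kw x * (gradSq u x + u x ^ 2) :=
      mul_le_mul_of_nonneg_right (hK1 x) (add_nonneg (hG0 x) (sq_nonneg _))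
    have b2 : 0 ≤ ‖x‖ ^ 2 * gradSq u x := by have := hG0 x; positivity
    have b3 : 0 ≤ u x ^ 2 * ‖x‖ ^ 2 := by positivity
    have b4 := hG0 x
    have b5 := sq_nonneg (u x)
    refine (norm_add_le _ _).trans ?_
    rw [Real.norm_eq_abs, Real.norm_eq_abs, abs_of_nonneg (a := 1/4 * (u x ^ 2 * ‖x‖ ^ 2))
      (by positivity)]
    nlinarith
  have hE : IntegrableOn (fun x => u x * radial u x + 1/4 * (u x ^ 2 * ‖x‖ ^ 2))
      (upperHS (n+1) h) := by
    refine Integrable.mono' (hX.const_mul 8) ?_ (Eventually.of_forall hEb)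
    refine ContinuousOn.aestronglyMeasurable ?_ hUm
    exact (hucU.mul hrc).add (continuousOn_const.mul ((hucU.pow 2).mul
      (Continuous.continuousOn (by fun_prop))))
  have hid := fun k : ℕ => cut_identity h f g hf u h2 h1 hpde hbc hG hu2 hE ((k:ℝ)+1)
    (by positivity)
  have hGu : IntegrableOn (fun x => gradSq u x + (n+1 : ℝ)/4 * u x ^ 2) (upperHS (n+1) h) :=
    hG.add (hu2.const_mul _)
  have hmem : ∀ y : Euc n, emb (n+1) y ∈ upperHSc (n+1) h := fun y => (emb_last h y).ge
  have hubc : Continuous fun y : Euc n => u (emb (n+1) y) :=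
    huc.comp_continuous emb_cont hmem
  have hgint : ∀ k : ℕ, Integrable fun y : Euc n => cutη ((k:ℝ)+1) (emb (n+1) y) *
      (u (emb (n+1) y) * g (u (emb (n+1) y))) := by
    intro k
    apply Continuous.integrable_of_hasCompactSupport
    · exact ((cutη_cont _).comp emb_cont).mul (hubc.mul (hg.comp hubc))
    · refine HasCompactSupport.intro (isCompact_closedBall (0 : Euc n) ((k:ℝ)+1)) ?_
      intro y hy
      rw [cutη_zero (by positivity), zero_mul]
      rw [emb_norm]
      simp only [Metric.mem_closedBall, dist_zero_right, not_le] at hy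
      exact hy.le
  -- bounds
  have hcb : ∀ (k : ℕ) (x : Euc (n+1)), ‖cutη ((k:ℝ)+1) x‖ ≤ 1 := fun k x => by
    rw [Real.norm_eq_abs, abs_of_nonneg (cutη_nonneg _ x)]; exact cutη_le_one _ x
  -- generic dominated convergence
  have dct : ∀ (F : Euc (n+1) → ℝ), IntegrableOn F (upperHS (n+1) h) →
      Tendsto (fun k : ℕ => ∫ x in upperHS (n+1) h, cutη ((k:ℝ)+1) x * F x) atTop
        (𝓝 (∫ x in upperHS (n+1) h, F x)) := by
    intro F hF
    refine tendsto_integral_of_dominated_convergence (fun x => ‖F x‖)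
      (fun k => (cutη_cont _).aestronglyMeasurable.mul hF.aestronglyMeasurable) hF.norm
      (fun k => Eventually.of_forall fun x => ?_) (Eventually.of_forall fun x => ?_)
    · rw [norm_mul]; exact mul_le_of_le_one_left (norm_nonneg _) (hcb k x)
    · simpa using (cutη_tendsto x).mul_const (F x)
  have dctb : ∀ (F : Euc n → ℝ), Integrable F →
      Tendsto (fun k : ℕ => ∫ y, cutη ((k:ℝ)+1) (emb (n+1) y) * F y) atTop
        (𝓝 (∫ y, F y)) := by
    intro F hF
    refine tendsto_integral_of_dominated_convergence (fun x => ‖F x‖)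
      (fun k => ((cutη_cont _).comp emb_cont).aestronglyMeasurable.mul hF.aestronglyMeasurable)
      hF.norm
      (fun k => Eventually.of_forall fun x => ?_) (Eventually.of_forall fun x => ?_)
    · rw [norm_mul]; exact mul_le_of_le_one_left (norm_nonneg _) (hcb k _)
    · simpa using (cutη_tendsto (emb (n+1) x)).mul_const (F x)
  have t1 := dct _ hGu
  have t3 : Tendsto (fun k : ℕ => ∫ x in upperHS (n+1) h, cutc ((k:ℝ)+1) x *
      (u x * radial u x + 1/4 * (u x ^ 2 * ‖x‖ ^ 2))) atTop (𝓝 0) := by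
    have hlim : Tendsto (fun k : ℕ => 4 / ((k:ℝ)+1) ^ 2) atTop (𝓝 0) :=
      ((tendsto_pow_atTop (two_ne_zero)).comp
        (tendsto_atTop_add_const_right _ (1:ℝ) tendsto_natCast_atTop_atTop)).const_div_atTop _
    have hlim' := hlim.mul_const (∫ x in upperHS (n+1) h,
      ‖u x * radial u x + 1/4 * (u x ^ 2 * ‖x‖ ^ 2)‖)
    rw [zero_mul] at hlim'
    refine squeeze_zero_norm (fun k => ?_) hlim'
    rw [← integral_const_mul]
    refine norm_integral_le_of_norm_le (hE.norm.const_mul _) (Eventually.of_forall fun x => ?_)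
    rw [norm_mul]
    exact mul_le_mul_of_nonneg_right (cutc_abs _ x) (norm_nonneg _)
  have tS : Tendsto (fun k : ℕ => (∫ x in upperHS (n+1) h, cutη ((k:ℝ)+1) x * (u x * f (u x)))
      + ∫ y : Euc n, cutη ((k:ℝ)+1) (emb (n+1) y) * (u (emb (n+1) y) * g (u (emb (n+1) y)))) atTop
      (𝓝 ((∫ x in upperHS (n+1) h, gradSq u x + (n+1 : ℝ)/4 * u x ^ 2) + 0)) := by
    refine (t1.add t3).congr fun k => ?_
    rw [← (hid k).2]; ring
  obtain ⟨C, hC⟩ := tS.bddAbove_range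
  have hC' : ∀ k : ℕ, (∫ x in upperHS (n+1) h, cutη ((k:ℝ)+1) x * (u x * f (u x)))
      + (∫ y : Euc n, cutη ((k:ℝ)+1) (emb (n+1) y) * (u (emb (n+1) y) * g (u (emb (n+1) y))))
      ≤ C := fun k => hC ⟨k, rfl⟩
  have p1 : ∀ k : ℕ, 0 ≤ ∫ x in upperHS (n+1) h, cutη ((k:ℝ)+1) x * (u x * f (u x)) := fun k =>
    integral_nonneg fun x => mul_nonneg (cutη_nonneg _ _) (hf0 _)
  have p2 : ∀ k : ℕ, 0 ≤ ∫ y : Euc n, cutη ((k:ℝ)+1) (emb (n+1) y) *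
      (u (emb (n+1) y) * g (u (emb (n+1) y))) := fun k =>
    integral_nonneg fun x => mul_nonneg (cutη_nonneg _ _) (hg0 _)
  have if1 : IntegrableOn (fun x => u x * f (u x)) (upperHS (n+1) h) :=
    integrable_of_cut _ (fun k x => cutη ((k:ℝ)+1) x) C (fun k x => cutη_nonneg _ _)
      (fun x => cutη_tendsto x) (fun x => hf0 _) (fun k => (hid k).1)
      (fun k => by linarith [hC' k, p2 k])
  have ig1 : Integrable (fun y : Euc n => u (emb (n+1) y) * g (u (emb (n+1) y))) :=
    integrable_of_cut _ (fun k y => cutη ((k:ℝ)+1) (emb (n+1) y)) C (fun k x => cutη_nonneg _ _)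
      (fun x => cutη_tendsto _) (fun x => hg0 _) hgint
      (fun k => by linarith [hC' k, p1 k])
  have hfin := tendsto_nhds_unique tS ((dct _ if1).add (dctb _ ig1))
  rw [integral_add hG (hu2.const_mul _), integral_const_mul] at hfin
  push_cast
  linarith

/-- Lemma 2.1, first Pohozaev identity. -/
theorem statement5 (N : ℕ) (hN : 3 ≤ N) (f g : ℝ → ℝ)
    (hf : Continuous f) (hg : Continuous g)
    (C₁ C₂ : ℝ) (hC₁ : 0 < C₁) (hC₂ : 0 < C₂)
    (hgrowf : ∀ t : ℝ, 0 ≤ t * f t ∧ t * f t ≤ C₁ * (t ^ 2 + |t| ^ twoStar N))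
    (hgrowg : ∀ t : ℝ, 0 ≤ t * g t ∧ t * g t ≤ C₂ * (t ^ 2 + |t| ^ twoStarL N))
    (u : Euc N → ℝ)
    (h2 : ContDiffOn ℝ 2 u (upperHS N (by omega)))
    (h1 : ContDiffOn ℝ 1 u (upperHSc N (by omega)))
    (hX : FiniteEnergy N (by omega) u)
    (hpde : ∀ x ∈ upperHS N (by omega : 0 < N),
      -lap u x - (1 / 2) * radial u x = f (u x))
    (hbc : ∀ x ∈ bdryHS N (by omega : 0 < N), -pdN N (by omega) u x = g (u x)) :
    (∫ x in upperHS N (by omega : 0 < N), gradSq u x)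
      - (∫ x in upperHS N (by omega : 0 < N), u x * f (u x))
      - (∫ y : Euc (N - 1), u (emb N y) * g (u (emb N y)))
      = -((N : ℝ) / 4) * ∫ x in upperHS N (by omega : 0 < N), (u x) ^ 2 := by 
  obtain ⟨n, rfl⟩ : ∃ n, N = n + 1 := ⟨N - 1, by omega⟩
  exact core (by omega) f g hf hg (fun t => (hgrowf t).1) (fun t => (hgrowg t).1) u h2 h1 hX
    hpde hbc
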